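/- arXiv:2012.07391 — 2 statements merged into one kernel-verified Lean document; each statement's English description precedes it below -/
import Mathlib

section
/- Let A and B be real Banach spaces and let ι : A → B be a compact continuous linear embedding. Let T > 0 and α ∈ (1/2, 1). Then every sequence (u_n) of strongly measurable functions u_n : [0,T] → A satisfying a uniform bound sup_n ( ∫₀ᵀ ‖u_n(t)‖_A² dt + ∫₀ᵀ∫₀ᵀ ‖u_n(t) − u_n(s)‖_A² / |t−s|^{1+2α} dt ds ) ≤ C < ∞ admits a subsequence (u_{n_k}) together with continuous functions v_k ∈ C([0,T]; B) such that v_k(t) = ι(u_{n_k}(t)) for almost every t ∈ [0,T], and (v_k) converges uniformly on [0,T] to some v ∈ C([0,T]; B). (In other words, the embedding W^{α,2}(0,T;A) ⊂ C([0,T];B) is compact for α > 1/2.) -/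
open MeasureTheory Set
open scoped ENNReal NNReal
open Filter Topology

/-- Jensen's inequality for the square of the norm on a probability space. -/
theorem enorm_integral_sq_le {X E : Type*} [MeasurableSpace X] {μ : Measure X}
    [IsProbabilityMeasure μ] [NormedAddCommGroup E] [NormedSpace ℝ E] {f : X → E}
    (hf : AEStronglyMeasurable f μ) : ‖∫ x, f x ∂μ‖ₑ ^ 2 ≤ ∫⁻ x, ‖f x‖ₑ ^ 2 ∂μ := by
  have h1 : ‖∫ x, f x ∂μ‖ₑ ≤ eLpNorm f 2 μ :=
    (enorm_integral_le_lintegral_enorm f).trans <| eLpNorm_one_eq_lintegral_enorm (f := f) ▸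
      eLpNorm_le_eLpNorm_of_exponent_le one_le_two hf
  have h2 := eLpNorm_nnreal_pow_eq_lintegral (f := f) (μ := μ) (p := 2) two_ne_zero
  calc ‖∫ x, f x ∂μ‖ₑ ^ 2 ≤ eLpNorm f 2 μ ^ 2 := by gcongr
    _ = _ := by simpa using h2

/-- The squared distance between two averages of a function is at most the mean of the squared
distances of its values. -/
theorem enorm_average_sub_average_sq_le {X E : Type*} [MeasurableSpace X] {μ ν : Measure X}
    [IsFiniteMeasure μ] [NeZero μ] [IsFiniteMeasure ν] [NeZero ν]
    [NormedAddCommGroup E] [NormedSpace ℝ E] [CompleteSpace E] {f : X → E}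
    (hμ : Integrable f μ) (hν : Integrable f ν) :
    ‖(⨍ x, f x ∂μ) - ⨍ y, f y ∂ν‖ₑ ^ 2 ≤ ⨍⁻ x, ⨍⁻ y, ‖f x - f y‖ₑ ^ 2 ∂ν ∂μ := by
  have hμ' : Integrable f ((μ univ)⁻¹ • μ) := hμ.smul_measure (by simp [NeZero.ne μ])
  have hν' : Integrable f ((ν univ)⁻¹ • ν) := hν.smul_measure (by simp [NeZero.ne ν])
  have key (c : E) : ‖(⨍ x, f x ∂μ) - c‖ₑ ^ 2 ≤ ⨍⁻ x, ‖f x - c‖ₑ ^ 2 ∂μ := by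
    have h : (⨍ x, f x ∂μ) - c = ∫ x, (f x - c) ∂((μ univ)⁻¹ • μ) := by
      rw [integral_sub hμ' (integrable_const c)]; simp [average]
    rw [h]
    exact enorm_integral_sq_le (hμ'.sub (integrable_const c)).1
  refine (key _).trans (lintegral_mono fun x => ?_)
  have h : f x - ⨍ y, f y ∂ν = ∫ y, (f x - f y) ∂((ν univ)⁻¹ • ν) := by
    rw [integral_sub (integrable_const _) hν']; simp [average]
  rw [h]
  exact enorm_integral_sq_le ((integrable_const _).sub hν').1

/-- Averages over an interval and over a subinterval of half its length are controlled by the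
fractional Sobolev seminorm. -/
theorem norm_setAverage_Icc_sub_le {E : Type*} [NormedAddCommGroup E] [NormedSpace ℝ E]
    [CompleteSpace E] {f : ℝ → E} {S : Set ℝ} {α C : ℝ} (hα : 0 < α) (hf : IntegrableOn f S)
    (hC : 0 ≤ C)
    (hbound : ∫⁻ t in S, ∫⁻ s in S,
      ‖f t - f s‖ₑ ^ 2 / ENNReal.ofReal (|t - s| ^ (1 + 2 * α)) ≤ ENNReal.ofReal C)
    {a b d : ℝ} (hd : 0 < d) (hI : Icc a (a + d) ⊆ S)
    (hJ : Icc b (b + d / 2) ⊆ Icc a (a + d)) :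
    ‖(⨍ t in Icc a (a + d), f t) - ⨍ t in Icc b (b + d / 2), f t‖ ≤
      √(2 * C) * d ^ (α - 1 / 2) := by
  have hvI : volume (Icc a (a + d)) = ENNReal.ofReal d := by simp
  have hvJ : volume (Icc b (b + d / 2)) = ENNReal.ofReal (d / 2) := by simp
  have : NeZero (volume.restrict (Icc a (a + d))) := ⟨by simp [hd]⟩
  have : NeZero (volume.restrict (Icc b (b + d / 2))) := ⟨by simp [hd]⟩
  have hmI : MeasurableSet (Icc a (a + d)) := measurableSet_Icc
  have hmJ : MeasurableSet (Icc b (b + d / 2)) := measurableSet_Icc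
  have h1 := enorm_average_sub_average_sq_le (hf.mono_set hI) (hf.mono_set (hJ.trans hI))
  have h2 (t s : ℝ) (ht : t ∈ Icc a (a + d)) (hs : s ∈ Icc b (b + d / 2)) :
      ‖f t - f s‖ₑ ^ 2 ≤ ENNReal.ofReal (d ^ (1 + 2 * α)) *
        (‖f t - f s‖ₑ ^ 2 / ENNReal.ofReal (|t - s| ^ (1 + 2 * α))) := by
    rcases eq_or_ne t s with rfl | hts
    · simp
    have hs' := hJ hs
    have hle : |t - s| ≤ d := by
      rw [abs_le]; constructor <;> linarith [ht.1, ht.2, hs'.1, hs'.2]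
    have h0 : 0 < |t - s| := abs_pos.2 (sub_ne_zero.2 hts)
    rw [← mul_div_assoc, ENNReal.le_div_iff_mul_le (by left; simp; positivity) (by simp), mul_comm]
    gcongr
  have h3 : ‖(⨍ t in Icc a (a + d), f t) - ⨍ t in Icc b (b + d / 2), f t‖ₑ ^ 2 ≤
      ENNReal.ofReal (2 * C * d ^ (2 * (α - 1 / 2))) := by
    refine h1.trans ?_
    simp only [setLAverage_eq, hvI, hvJ, ENNReal.div_eq_inv_mul]
    calc _ ≤ (ENNReal.ofReal d)⁻¹ * ∫⁻ t in Icc a (a + d), (ENNReal.ofReal (d / 2))⁻¹ *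
          ∫⁻ s in Icc b (b + d / 2), ENNReal.ofReal (d ^ (1 + 2 * α)) *
            (‖f t - f s‖ₑ ^ 2 / ENNReal.ofReal (|t - s| ^ (1 + 2 * α))) := by
          refine mul_le_mul_right ?_ _
          refine setLIntegral_mono' hmI fun t ht => ?_
          refine mul_le_mul_right ?_ _
          exact setLIntegral_mono' hmJ fun s hs => h2 t s ht hs
      _ ≤ (ENNReal.ofReal d)⁻¹ * ∫⁻ t in S, (ENNReal.ofReal (d / 2))⁻¹ *
          ∫⁻ s in S, ENNReal.ofReal (d ^ (1 + 2 * α)) *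
            (‖f t - f s‖ₑ ^ 2 / ENNReal.ofReal (|t - s| ^ (1 + 2 * α))) := by
          gcongr
          exact hJ.trans hI
      _ = (ENNReal.ofReal d)⁻¹ * ((ENNReal.ofReal (d / 2))⁻¹ * (ENNReal.ofReal (d ^ (1 + 2 * α)) *
          ∫⁻ t in S, ∫⁻ s in S,
            (‖f t - f s‖ₑ ^ 2 / ENNReal.ofReal (|t - s| ^ (1 + 2 * α))))) := by
          simp_rw [lintegral_const_mul' _ _ ENNReal.ofReal_ne_top]
          rw [lintegral_const_mul' _ _ (by simp [hd]),
            lintegral_const_mul' _ _ ENNReal.ofReal_ne_top]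
      _ ≤ (ENNReal.ofReal d)⁻¹ * ((ENNReal.ofReal (d / 2))⁻¹ * (ENNReal.ofReal (d ^ (1 + 2 * α)) *
          ENNReal.ofReal C)) := by gcongr
      _ = _ := by
          rw [← ENNReal.ofReal_inv_of_pos hd, ← ENNReal.ofReal_inv_of_pos (by positivity),
            ← ENNReal.ofReal_mul (by positivity), ← ENNReal.ofReal_mul (by positivity),
            ← ENNReal.ofReal_mul (by positivity)]
          congr 1
          have : d ^ (1 + 2 * α) = d ^ (2 * (α - 1 / 2)) * d ^ 2 := by
            rw [← Real.rpow_add_natCast hd.ne']; congr 1; push_cast; ring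
          rw [this]
          field_simp
  rw [← ofReal_norm, ← ENNReal.ofReal_pow (norm_nonneg _),
    ENNReal.ofReal_le_ofReal_iff (by positivity)] at h3
  refine (pow_le_pow_iff_left₀ (norm_nonneg _) (by positivity) two_ne_zero).1 ?_
  rw [mul_pow, Real.sq_sqrt (by positivity), ← Real.rpow_mul_natCast hd.le]
  rwa [Nat.cast_two, mul_comm (α - 1 / 2)]

/-- If averages over a nested sequence of intervals of halving lengths converge, the distance of the
first average to the limit is controlled by the fractional Sobolev seminorm. -/
theorem dist_setAverage_Icc_le {E : Type*} [NormedAddCommGroup E] [NormedSpace ℝ E]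
    [CompleteSpace E] {f : ℝ → E} {S : Set ℝ} {α C : ℝ} (hα : 1 / 2 < α) (hf : IntegrableOn f S)
    (hC : 0 ≤ C)
    (hbound : ∫⁻ t in S, ∫⁻ s in S,
      ‖f t - f s‖ₑ ^ 2 / ENNReal.ofReal (|t - s| ^ (1 + 2 * α)) ≤ ENNReal.ofReal C)
    {c : ℕ → ℝ} {d : ℝ} (hd : 0 < d) {x : E} (hS : ∀ k, Icc (c k) (c k + d / 2 ^ k) ⊆ S)
    (hanti : ∀ k, Icc (c (k + 1)) (c (k + 1) + d / 2 ^ (k + 1)) ⊆ Icc (c k) (c k + d / 2 ^ k))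
    (hx : Tendsto (fun k => ⨍ t in Icc (c k) (c k + d / 2 ^ k), f t) atTop (𝓝 x)) :
    dist (⨍ t in Icc (c 0) (c 0 + d), f t) x ≤
      √(2 * C) * d ^ (α - 1 / 2) / (1 - (1 / 2) ^ (α - 1 / 2)) := by
  have hr : (1 / 2 : ℝ) ^ (α - 1 / 2) < 1 :=
    Real.rpow_lt_one (by norm_num) (by norm_num) (by linarith)
  have := dist_le_of_le_geometric_of_tendsto₀ _ (√(2 * C) * d ^ (α - 1 / 2)) hr (fun k => ?_) hx
  · simpa using this
  have e : d / 2 ^ (k + 1) = d / 2 ^ k / 2 := by rw [pow_succ]; field_simp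
  have h := norm_setAverage_Icc_sub_le (by linarith) hf hC hbound (d := d / 2 ^ k)
    (by positivity) (hS k) (b := c (k + 1)) (e ▸ hanti k)
  rw [dist_eq_norm, e]
  refine h.trans_eq ?_
  rw [div_eq_mul_inv d, Real.mul_rpow hd.le (by positivity), ← inv_pow, one_div 2,
    Real.rpow_pow_comm (by norm_num), mul_assoc]


/-- Lebesgue differentiation along intervals inside `S` shrinking geometrically to a point. -/
theorem ae_tendsto_setAverage_Icc {E : Type*} [NormedAddCommGroup E] [NormedSpace ℝ E]
    [CompleteSpace E] {f : ℝ → E} {S : Set ℝ} (hS : MeasurableSet S) (hf : IntegrableOn f S) :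
    ∀ᵐ t ∂volume.restrict S, ∀ (c : ℕ → ℝ) (d : ℝ), 0 < d →
      (∀ k, t ∈ Icc (c k) (c k + d / 2 ^ k)) → (∀ k, Icc (c k) (c k + d / 2 ^ k) ⊆ S) →
      Tendsto (fun k => ⨍ s in Icc (c k) (c k + d / 2 ^ k), f s) atTop (𝓝 (f t)) := by
  have hg : LocallyIntegrable (S.indicator f) := (hf.integrable_indicator hS).locallyIntegrable
  rw [ae_restrict_iff' hS]
  filter_upwards [IsUnifLocDoublingMeasure.ae_tendsto_average volume hg 1] with t ht htS c d hd htc hcS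
  have hball (k : ℕ) : Metric.closedBall (c k + d / 2 ^ k / 2) (d / 2 ^ k / 2) =
      Icc (c k) (c k + d / 2 ^ k) := by
    rw [Real.closedBall_eq_Icc]; congr 1 <;> ring
  have h0 : Tendsto (fun k : ℕ => d / 2 ^ k / 2) atTop (𝓝[>] 0) := by
    refine tendsto_nhdsWithin_iff.2 ⟨?_, Eventually.of_forall fun k => by
      simp only [mem_Ioi]; positivity⟩
    have := (tendsto_pow_atTop_nhds_zero_of_lt_one (r := (1 / 2 : ℝ)) (by norm_num)
      (by norm_num)).const_mul (d / 2)
    rw [mul_zero] at this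
    refine this.congr fun k => ?_
    rw [one_div, inv_pow]; ring
  have := ht (fun k => c k + d / 2 ^ k / 2) _ h0
    (Eventually.of_forall fun k => by rw [one_mul, hball]; exact htc k)
  rw [indicator_of_mem htS] at this
  refine this.congr fun k => ?_
  rw [hball, setAverage_eq, setAverage_eq, setIntegral_congr_fun measurableSet_Icc]
  exact fun s hs => indicator_of_mem (hcS k hs) f

/-- A function of finite `W^{α,2}` seminorm with `α > 1/2` agrees on a set of full measure with a
Hölder continuous function of exponent `α - 1/2`. -/
theorem exists_ae_dist_le_rpow {E : Type*} [NormedAddCommGroup E] [NormedSpace ℝ E]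
    [CompleteSpace E] {f : ℝ → E} {a b α C : ℝ} (hα : 1 / 2 < α)
    (hf : IntegrableOn f (Icc a b)) (hC : 0 ≤ C)
    (hbound : ∫⁻ t in Icc a b, ∫⁻ s in Icc a b,
      ‖f t - f s‖ₑ ^ 2 / ENNReal.ofReal (|t - s| ^ (1 + 2 * α)) ≤ ENNReal.ofReal C) :
    ∃ G ⊆ Icc a b, (∀ᵐ t ∂volume.restrict (Icc a b), t ∈ G) ∧ ∀ t ∈ G, ∀ s ∈ G,
      dist (f t) (f s) ≤
        2 * √(2 * C) / (1 - (1 / 2) ^ (α - 1 / 2)) * dist t s ^ (α - 1 / 2) := by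
  refine ⟨{t | t ∈ Icc a b ∧ ∀ (c : ℕ → ℝ) (d : ℝ), 0 < d →
      (∀ k, t ∈ Icc (c k) (c k + d / 2 ^ k)) → (∀ k, Icc (c k) (c k + d / 2 ^ k) ⊆ Icc a b) →
      Tendsto (fun k => ⨍ s in Icc (c k) (c k + d / 2 ^ k), f s) atTop (𝓝 (f t))},
    fun t ht => ht.1, (ae_restrict_mem measurableSet_Icc).and
      (ae_tendsto_setAverage_Icc measurableSet_Icc hf), ?_⟩
  intro t ht s hs
  wlog hst : s < t generalizing t s
  · rcases (not_lt.1 hst).eq_or_lt with rfl | hlt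
    · rw [dist_self, dist_self, Real.zero_rpow (by linarith), mul_zero]
    · rw [dist_comm (f t), dist_comm t]
      exact this s hs t ht hlt
  obtain ⟨d, hd, rfl⟩ : ∃ d, 0 < d ∧ t = s + d := ⟨t - s, by linarith, by ring⟩
  have hpos (k : ℕ) : 0 < d / 2 ^ k := by positivity
  have hle (k : ℕ) : d / 2 ^ k ≤ d := div_le_self hd.le (one_le_pow₀ one_le_two)
  have hsucc (k : ℕ) : d / 2 ^ (k + 1) ≤ d / 2 ^ k := by gcongr <;> norm_num
  have hl (k : ℕ) : Icc s (s + d / 2 ^ k) ⊆ Icc a b :=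
    Icc_subset_Icc hs.1.1 (by linarith [ht.1.2, hle k])
  have hr (k : ℕ) : Icc (s + d - d / 2 ^ k) (s + d - d / 2 ^ k + d / 2 ^ k) ⊆ Icc a b :=
    Icc_subset_Icc (by linarith [hs.1.1, hle k]) (by linarith [ht.1.2])
  have h1 := dist_setAverage_Icc_le hα hf hC hbound hd hl
    (fun k => Icc_subset_Icc le_rfl (by linarith [hsucc k]))
    (hs.2 (fun _ => s) d hd (fun k => ⟨le_rfl, by linarith [hpos k]⟩) hl)
  have h2 := dist_setAverage_Icc_le hα hf hC hbound hd hr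
    (fun k => Icc_subset_Icc (by linarith [hsucc k]) (by linarith))
    (ht.2 (fun k => s + d - d / 2 ^ k) d hd
      (fun k => ⟨by linarith [hpos k], by linarith⟩) hr)
  simp only [pow_zero, div_one, add_sub_cancel_right] at h2
  have hds : dist (s + d) s = d := by simp [abs_of_pos hd]
  rw [hds]
  calc _ ≤ _ := dist_triangle_left _ _ _
    _ ≤ _ := add_le_add h2 h1
    _ = _ := by ring

/-- A function that is Hölder continuous and takes values in a compact set almost everywhere on an
interval has a Hölder continuous representative with values in that set. -/
theorem exists_continuousMap_ae_eq_of_ae_dist_le {B : Type*} [MetricSpace B] [CompleteSpace B]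
    {T : ℝ} (hT : 0 < T) {g : ℝ → B} {G : Set ℝ} {K : Set B} {M β : ℝ} (hβ : 0 < β)
    (hGae : ∀ᵐ t ∂volume.restrict (Icc 0 T), t ∈ G) (hK : IsClosed K)
    (hgK : ∀ t ∈ G, g t ∈ K) (hg : ∀ t ∈ G, ∀ s ∈ G, dist (g t) (g s) ≤ M * dist t s ^ β) :
    ∃ v : C(Icc 0 T, B), (∀ x, v x ∈ K) ∧ (∀ x y, dist (v x) (v y) ≤ M * dist x y ^ β) ∧
      ∀ x : Icc 0 T, (x : ℝ) ∈ G → v x = g x := by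
  have hdense : Dense {x : Icc 0 T | (x : ℝ) ∈ G} := by
    rw [Subtype.dense_iff]
    refine (closure_Ioo hT.ne).ge.trans <| closure_minimal ?_ isClosed_closure
    rw [ae_restrict_iff' measurableSet_Icc] at hGae
    refine ((Measure.dense_of_ae hGae).open_subset_closure_inter isOpen_Ioo).trans
      (closure_mono fun t ht => ?_)
    have htI := Ioo_subset_Icc_self ht.1
    exact ⟨⟨t, htI⟩, ht.2 htI, rfl⟩
  have hlim : Tendsto (fun d : ℝ => M * d ^ β) (𝓝 0) (𝓝 0) := by
    have : Continuous fun d : ℝ => M * d ^ β :=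
      continuous_const.mul (Real.continuous_rpow_const hβ.le)
    simpa [Real.zero_rpow hβ.ne'] using this.tendsto 0
  let g' : {x : Icc 0 T | (x : ℝ) ∈ G} → B := fun x => g x
  have hu : UniformContinuous g' := by
    refine Metric.uniformContinuous_iff.2 fun ε hε => ?_
    obtain ⟨δ, hδ, h⟩ := Metric.eventually_nhds_iff.1 (hlim.eventually_lt_const hε)
    refine ⟨δ, hδ, fun {x y} hxy => (hg _ x.2 _ y.2).trans_lt (h ?_)⟩
    rw [Real.dist_0_eq_abs, abs_of_nonneg dist_nonneg]
    exact hxy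
  have hv := (hdense.uniformContinuous_extend hu).continuous
  have hvg (x : Icc 0 T) (hx : (x : ℝ) ∈ G) : hdense.extend g' x = g x :=
    hdense.extend_of_ind hu ⟨x, hx⟩
  refine ⟨⟨hdense.extend g', hv⟩, fun x => ?_, fun x y => ?_, hvg⟩
  · exact hdense.induction (fun x hx => by simpa [hvg x hx] using hgK _ hx)
      (hK.preimage hv) x
  · refine (hdense.prod hdense).induction (P := fun p : Icc 0 T × Icc 0 T =>
      dist (hdense.extend g' p.1) (hdense.extend g' p.2) ≤ M * dist p.1 p.2 ^ β)
      (fun p hp => ?_) ?_ (x, y)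
    · rw [hvg _ hp.1, hvg _ hp.2]
      exact hg _ hp.1 _ hp.2
    · refine isClosed_le (by fun_prop) (continuous_const.mul
        ((Real.continuous_rpow_const hβ.le).comp continuous_dist))

/-- Compact embedding `W^{α,2}(0,T;A) ⊂ C([0,T];B)` for `α > 1/2`
(Flandoli–Gatarek): any sequence bounded in `W^{α,2}(0,T;A)` has a subsequence
whose composition with the compact embedding `ι : A → B` agrees a.e. with
continuous functions converging uniformly on `[0,T]`. -/
theorem fractional_sobolev_compact_embedding
    {A B : Type*} [NormedAddCommGroup A] [NormedSpace ℝ A] [CompleteSpace A]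
    [NormedAddCommGroup B] [NormedSpace ℝ B] [CompleteSpace B]
    (ι : A →L[ℝ] B) (hι_compact : IsCompactOperator ι)
    (hι_inj : Function.Injective ι)
    (T : ℝ) (hT : 0 < T) (α : ℝ) (hα₁ : 1 / 2 < α) (hα₂ : α < 1)
    (u : ℕ → ℝ → A)
    (hmeas : ∀ n, AEStronglyMeasurable (u n) (volume.restrict (Icc (0:ℝ) T)))
    (C : ℝ≥0∞) (hC : C < ⊤)
    (hbound : ∀ n,
      (∫⁻ t in Icc (0:ℝ) T, (‖u n t‖₊ : ℝ≥0∞) ^ 2)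
        + ∫⁻ t in Icc (0:ℝ) T, ∫⁻ s in Icc (0:ℝ) T,
            (‖u n t - u n s‖₊ : ℝ≥0∞) ^ 2 / ENNReal.ofReal (|t - s| ^ (1 + 2 * α))
      ≤ C) :
    ∃ φ : ℕ → ℕ, StrictMono φ ∧
      ∃ v : ℕ → ℝ → B, ∃ w : ℝ → B,
        (∀ k, ContinuousOn (v k) (Icc (0:ℝ) T)) ∧
        (∀ k, ∀ᵐ t ∂(volume.restrict (Icc (0:ℝ) T)), v k t = ι (u (φ k) t)) ∧
        ContinuousOn w (Icc (0:ℝ) T) ∧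
        TendstoUniformlyOn v w Filter.atTop (Icc (0:ℝ) T) := by
  have hL2 (n : ℕ) : ∫⁻ t in Icc 0 T, ‖u n t‖ₑ ^ 2 ≤ C := le_self_add.trans (hbound n)
  have hint (n : ℕ) : IntegrableOn (u n) (Icc 0 T) := by
    have : MemLp (u n) 2 (volume.restrict (Icc 0 T)) := by
      refine ⟨hmeas n, ?_⟩
      rw [eLpNorm_lt_top_iff_lintegral_rpow_enorm_lt_top two_ne_zero ENNReal.ofNat_ne_top]
      simpa using (hL2 n).trans_lt hC
    exact this.integrable one_le_two
  set β := α - 1 / 2 with hβ_def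
  have hβ : 0 < β := by linarith
  set M := 2 * √(2 * C.toReal) / (1 - (1 / 2) ^ β) with hM_def
  have hM : 0 ≤ M := by
    have : (1 / 2 : ℝ) ^ β ≤ 1 := Real.rpow_le_one (by norm_num) (by norm_num) hβ.le
    exact div_nonneg (by positivity) (by linarith)
  have hG (n : ℕ) := exists_ae_dist_le_rpow (f := u n) (C := C.toReal) hα₁ (hint n)
    ENNReal.toReal_nonneg (by
      rw [ENNReal.ofReal_toReal hC.ne]; exact le_add_self.trans (hbound n))
  choose G hGsub hGae hGd using hG
  obtain ⟨R, hR⟩ : ∃ R, ∀ n, ∀ t ∈ G n, u n t ∈ Metric.closedBall 0 R := by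
    refine ⟨√(C.toReal / T) + M * T ^ β, fun n t ht => ?_⟩
    obtain ⟨s, hs, hsle⟩ := exists_notMem_null_le_laverage
      (by simp [hT] : volume.restrict (Icc 0 T) ≠ 0) ((hmeas n).enorm.pow_const 2) (hGae n)
    have hs : s ∈ G n := not_not.1 hs
    have h1 : ‖u n s‖ ≤ √(C.toReal / T) := by
      refine Real.le_sqrt_of_sq_le ?_
      rw [← ENNReal.ofReal_le_ofReal_iff (by positivity), ENNReal.ofReal_pow (norm_nonneg _),
        ofReal_norm, ENNReal.ofReal_div_of_pos hT, ENNReal.ofReal_toReal hC.ne]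
      refine hsle.trans ?_
      rw [setLAverage_eq, Real.volume_Icc, sub_zero]
      gcongr
      exact hL2 n
    have h2 : dist (u n t) (u n s) ≤ M * T ^ β := by
      refine (hGd n t ht s hs).trans ?_
      gcongr
      simpa using Real.dist_le_of_mem_Icc (hGsub n ht) (hGsub n hs)
    rw [mem_closedBall_zero_iff]
    rw [dist_eq_norm] at h2
    linarith [norm_le_norm_add_norm_sub' (u n t) (u n s)]
  have hK : IsCompact (closure (ι '' Metric.closedBall 0 R)) :=
    hι_compact.isCompact_closure_image_closedBall R
  have hv (n : ℕ) := exists_continuousMap_ae_eq_of_ae_dist_le hT (g := fun t => ι (u n t))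
    (M := ‖ι‖ * M) hβ (hGae n) isClosed_closure
    (fun t ht => subset_closure (mem_image_of_mem ι (hR n t ht)))
    (fun t ht s hs => (ι.lipschitz.dist_le_mul _ _).trans (by
      rw [mul_assoc]
      exact mul_le_mul_of_nonneg_left (hGd n t ht s hs) (norm_nonneg ι)))
  choose v hvK hvd hvu using hv
  let V (n : ℕ) : BoundedContinuousFunction (Icc 0 T) B := .mkOfCompact (v n)
  have hcomp : IsCompact (closure (range V)) := by
    refine BoundedContinuousFunction.arzela_ascoli _ hK _ ?_ ?_
    · rintro _ x ⟨n, rfl⟩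
      exact hvK n x
    · refine Metric.equicontinuous_of_continuity_modulus (fun d => ‖ι‖ * M * d ^ β) ?_ _ ?_
      · have : Continuous fun d : ℝ => ‖ι‖ * M * d ^ β :=
          continuous_const.mul (Real.continuous_rpow_const hβ.le)
        simpa [Real.zero_rpow hβ.ne'] using this.tendsto 0
      · rintro x y ⟨_, n, rfl⟩
        exact hvd n x y
  obtain ⟨w, -, φ, hφ, hw⟩ := hcomp.tendsto_subseq fun n => subset_closure (mem_range_self n)
  refine ⟨φ, hφ, fun k => IccExtend hT.le (V (φ k)), IccExtend hT.le w,
    fun k => (V (φ k)).continuous.Icc_extend'.continuousOn, fun k => ?_,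
    w.continuous.Icc_extend'.continuousOn, ?_⟩
  · filter_upwards [hGae (φ k)] with t ht
    rw [IccExtend_of_mem hT.le _ (hGsub _ ht)]
    exact hvu _ _ ht
  · have := BoundedContinuousFunction.tendsto_iff_tendstoUniformly.1 hw
    exact (this.comp (projIcc 0 T hT.le)).tendstoUniformlyOn
end

section
/- Let γ > 1 and 0 < a ≤ b. Then there exists a constant C > 0 such that for every r ∈ [a, b] and every ρ ≥ 0 with either ρ ≤ r/2 or ρ ≥ 2r, one has 1 + ρ^γ ≤ C ( P(ρ) − P'(r)(ρ − r) − P(r) ), where P(ρ) = ρ^γ/(γ−1). -/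
/-- A power with exponent greater than one exceeds its tangent line at `1` by at least a fixed
fraction of `1 + s ^ γ`, uniformly for `s` outside `(1/2, 2)`. -/
theorem exists_one_add_rpow_le_mul_rpow_sub_tangent {γ : ℝ} (hγ : 1 < γ) :
    ∃ K : ℝ, 0 < K ∧ ∀ s : ℝ, 0 ≤ s → (s ≤ 1 / 2 ∨ 2 ≤ s) →
      1 + s ^ γ ≤ K * (s ^ γ - 1 - γ * (s - 1)) := by
  have hconv := convexOn_rpow hγ.le
  have h2 : 0 < (2 : ℝ) ^ γ - 1 - γ := by
    have h := one_add_mul_self_lt_rpow_one_add (s := 1) (by norm_num) (by norm_num) hγ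
    norm_num at h
    linarith
  have hhalf : 0 < (1 / 2 : ℝ) ^ γ - 1 + γ / 2 := by
    have h := one_add_mul_self_lt_rpow_one_add (s := -(1 / 2)) (by norm_num) (by norm_num) hγ
    rw [show (1 : ℝ) + -(1 / 2) = 1 / 2 by norm_num] at h
    linarith
  set A := (2 : ℝ) ^ γ - 1 - γ with hA
  set B := (1 / 2 : ℝ) ^ γ - 1 + γ / 2 with hB
  refine ⟨1 + (2 + γ) / A + 2 / B, by positivity, fun s hs hfar ↦ ?_⟩
  set g := s ^ γ - 1 - γ * (s - 1) with hg
  rcases hfar with hle | hge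
  · have hsec := hconv.secant_mono (a := 1) (x := s) (y := 1 / 2) (Set.mem_Ici.2 zero_le_one)
      (Set.mem_Ici.2 hs) (Set.mem_Ici.2 (by norm_num)) (by linarith) (by norm_num) hle
    rw [Real.one_rpow, div_le_iff_of_neg (by linarith)] at hsec
    have hgB : B ≤ g := by
      norm_num at hsec
      nlinarith [mul_nonneg hhalf.le (sub_nonneg.2 hle)]
    have hone : s ^ γ ≤ 1 := Real.rpow_le_one hs (by linarith) (by linarith)
    have hg0 : 0 < g := hhalf.trans_le hgB
    have h1 : 2 ≤ 2 / B * g := by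
      rw [div_mul_eq_mul_div, le_div_iff₀ hhalf]
      linarith
    have h3 : 0 ≤ (1 + (2 + γ) / A) * g := by positivity
    linarith
  · have hsec := hconv.secant_mono (a := 1) (x := 2) (y := s) (Set.mem_Ici.2 zero_le_one)
      (Set.mem_Ici.2 zero_le_two) (Set.mem_Ici.2 hs) (by norm_num) (by linarith) hge
    rw [Real.one_rpow, le_div_iff₀ (by linarith)] at hsec
    have hgA : A * (s - 1) ≤ g := by
      norm_num at hsec
      nlinarith
    have hg0 : 0 < g := (mul_pos h2 (by linarith)).trans_le hgA
    have h1 : (2 + γ) * (s - 1) ≤ (2 + γ) / A * g := by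
      rw [div_mul_eq_mul_div, le_div_iff₀ h2]
      nlinarith
    have h3 : 0 ≤ 2 / B * g := by positivity
    linarith

/-- Far-field coercivity of the relative pressure potential: for `γ > 1` and
`r` in a compact subinterval `[a,b] ⊂ (0,∞)`, if `ρ ≤ r/2` or `ρ ≥ 2r` then
`1 + ρ^γ ≤ C (P(ρ) - P'(r)(ρ-r) - P(r))` with `P(ρ) = ρ^γ/(γ-1)`. -/
theorem relative_pressure_potential_far_field_coercivity
    (γ : ℝ) (hγ : 1 < γ) (a b : ℝ) (ha : 0 < a) (hab : a ≤ b) :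
    ∃ C : ℝ, 0 < C ∧ ∀ r : ℝ, r ∈ Set.Icc a b → ∀ ρ : ℝ, 0 ≤ ρ →
      (ρ ≤ r / 2 ∨ 2 * r ≤ ρ) →
      1 + ρ ^ γ
        ≤ C * (ρ ^ γ / (γ - 1) - (γ * r ^ (γ - 1) / (γ - 1)) * (ρ - r) - r ^ γ / (γ - 1)) := by
  obtain ⟨K, hK, hmain⟩ := exists_one_add_rpow_le_mul_rpow_sub_tangent hγ
  have hγ1 : 0 < γ - 1 := by linarith
  have haγ : 0 < a ^ γ := Real.rpow_pos_of_pos ha γ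
  refine ⟨(1 / a ^ γ + 1) * (γ - 1) * K, by positivity, fun r hr ρ hρ hfar ↦ ?_⟩
  have hr0 : 0 < r := ha.trans_le hr.1
  obtain ⟨s, rfl⟩ : ∃ s, ρ = r * s := ⟨ρ / r, by field_simp⟩
  have hs : 0 ≤ s := nonneg_of_mul_nonneg_right hρ hr0
  have hfar' : s ≤ 1 / 2 ∨ 2 ≤ s := by
    refine hfar.imp (fun h ↦ ?_) (fun h ↦ ?_) <;> nlinarith
  have hrγ : r ^ γ = r ^ (γ - 1) * r := by
    rw [← Real.rpow_add_one hr0.ne', sub_add_cancel]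
  have har : a ^ γ ≤ r ^ γ := Real.rpow_le_rpow ha.le hr.1 (by linarith)
  have hR : 1 ≤ 1 / a ^ γ * r ^ γ := by
    rwa [div_mul_eq_mul_div, one_mul, one_le_div haγ]
  have hsγ : 0 ≤ s ^ γ := Real.rpow_nonneg hs γ
  have hrγ0 : 0 < r ^ γ := haγ.trans_le har
  rw [Real.mul_rpow hr0.le hs]
  calc 1 + r ^ γ * s ^ γ ≤ (1 / a ^ γ + 1) * r ^ γ * (1 + s ^ γ) := by nlinarith
    _ ≤ (1 / a ^ γ + 1) * r ^ γ * (K * (s ^ γ - 1 - γ * (s - 1))) := by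
        gcongr
        exact hmain s hs hfar'
    _ = _ := by
        rw [hrγ]
        field_simp
        ring
end
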